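/- Let X be a locally compact Hausdorff space, H a separable complex Hilbert space, and p ∈ [1,∞). Let T : X → B(H) be bounded and *-strongly continuous, and assume tr|T(x)|^p < ∞ for every x and that the function x ↦ tr|T(x)|^p lies in C₀(X). Let (e_i) be an orthonormal basis of H, and for n ≥ 0 let P_n be the orthogonal projection onto span(e_1,…,e_n) and T_n(x) := P_n T(x) P_n. Then each T_n belongs to C₀(X, S_p(H)), and for all m ≥ n: sup_{x∈X} ‖T_m(x) − T_n(x)‖_p^{2p} ≤ 2^{2p−1} · sup_{x∈X} [ tr|T(x)|^p · ∑_{i=n+1}^m ⟨e_i, (|T(x)|^p + |T(x)*|^p) e_i⟩ ]. -/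

import Mathlib

open ContinuousLinearMap Filter Topology

noncomputable section

variable {H : Type*} [NormedAddCommGroup H] [InnerProductSpace ℂ H] [CompleteSpace H]
  [TopologicalSpace.SeparableSpace H]

local notation "⟪" x ", " y "⟫" => @inner ℂ _ _ x y

/-- `|T|^p = (T*T)^{p/2}`, via the continuous functional calculus. -/
def absPow (T : H →L[ℂ] H) (p : ℝ) : H →L[ℂ] H :=
  cfc (fun t : ℝ => t ^ (p / 2)) (ContinuousLinearMap.adjoint T ∘L T)

/-- The trace `∑ᵢ ⟨fᵢ, A fᵢ⟩ ∈ [0,∞]` of a positive operator `A`, computed in the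
orthonormal basis `f` (for positive `A` the value is independent of the basis). -/
def posTr (f : HilbertBasis ℕ ℂ H) (A : H →L[ℂ] H) : ENNReal :=
  ∑' i, ENNReal.ofReal (RCLike.re ⟪f i, A (f i)⟫)

/-- `tr |T|^p ∈ [0,∞]`. `T` lies in the Schatten class `S_p(H)` iff this is finite. -/
def trAbsPow (f : HilbertBasis ℕ ℂ H) (T : H →L[ℂ] H) (p : ℝ) : ENNReal :=
  posTr f (absPow T p)

/-- The Schatten `p`-norm `‖T‖_p = (tr |T|^p)^{1/p}`. -/
def sNorm (f : HilbertBasis ℕ ℂ H) (p : ℝ) (T : H →L[ℂ] H) : ℝ :=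
  (trAbsPow f T p).toReal ^ (1 / p)

/-- `T : X → B(H)` belongs to `C₀(X, S_p(H))`: pointwise Schatten class, continuous
with respect to the Schatten `p`-norm, and vanishing at infinity with respect to it. -/
def IsC0Schatten (f : HilbertBasis ℕ ℂ H) (p : ℝ) {X : Type*} [TopologicalSpace X]
    (T : X → H →L[ℂ] H) : Prop :=
  (∀ x, trAbsPow f (T x) p ≠ ⊤) ∧
  (∀ x, Tendsto (fun y => sNorm f p (T y - T x)) (nhds x) (nhds 0)) ∧
  Tendsto (fun x => sNorm f p (T x)) (cocompact X) (nhds 0)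

section

omit [TopologicalSpace.SeparableSpace H]

theorem cfc_mul_eq_mul_cfc_of_mul_eq {a b S : H →L[ℂ] H} (ha : IsSelfAdjoint a)
    (hb : IsSelfAdjoint b) (h : a * S = S * b) {g : ℝ → ℝ} (hg : Continuous g) :
    cfc g a * S = S * cfc g b := by
  have hpoly : ∀ q : Polynomial ℝ, Polynomial.aeval a q * S = S * Polynomial.aeval b q := by
    intro q
    induction q using Polynomial.induction_on' with
    | add q r hq hr => simp only [map_add, add_mul, mul_add, hq, hr]
    | monomial n c =>
      have : ∀ n : ℕ, a ^ n * S = S * b ^ n := by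
        intro n
        induction n with
        | zero => simp
        | succ n ih => rw [pow_succ, mul_assoc, h, ← mul_assoc, ih, mul_assoc, ← pow_succ]
      rw [Polynomial.aeval_monomial, Polynomial.aeval_monomial, mul_assoc, this,
        ← mul_assoc, Algebra.commutes, mul_assoc]
  set M : ℝ := max ‖a‖ ‖b‖ with hM
  have hspec : ∀ c : H →L[ℂ] H, ‖c‖ ≤ M → ∀ x ∈ spectrum ℝ c, x ∈ Set.Icc (-M) M := by
    intro c hc x hx
    have h1 : ‖x‖ ≤ ‖c‖ := by
      by_cases hH : Nontrivial H
      · exact spectrum.norm_le_norm_of_mem hx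
      · rw [not_nontrivial_iff_subsingleton] at hH
        simp at hx
    exact abs_le.mp (h1.trans hc)
  have key : ∀ δ > 0, ‖cfc g a * S - S * cfc g b‖ ≤ 2 * ‖S‖ * δ := by
    intro δ hδ
    obtain ⟨q, hq⟩ := exists_polynomial_near_of_continuousOn (-M) M g hg.continuousOn δ hδ
    have happ : ∀ c : H →L[ℂ] H, IsSelfAdjoint c → ‖c‖ ≤ M →
        ‖cfc g c - Polynomial.aeval c q‖ ≤ δ := by
      intro c hc hcM
      rw [← cfc_polynomial q c hc, ← cfc_sub g q.eval c hg.continuousOn q.continuous.continuousOn]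
      refine norm_cfc_le hδ.le fun x hx => ?_
      rw [norm_sub_rev]
      exact (hq x (hspec c hcM x hx)).le
    have e : cfc g a * S - S * cfc g b =
        (cfc g a - Polynomial.aeval a q) * S - S * (cfc g b - Polynomial.aeval b q) := by
      rw [sub_mul, mul_sub, hpoly]; abel
    rw [e]
    refine (norm_sub_le _ _).trans ?_
    have h1 := (norm_mul_le (cfc g a - Polynomial.aeval a q) S).trans
      (mul_le_mul_of_nonneg_right (happ a ha (le_max_left _ _)) (norm_nonneg _))
    have h2 := (norm_mul_le S (cfc g b - Polynomial.aeval b q)).trans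
      (mul_le_mul_of_nonneg_left (happ b hb (le_max_right _ _)) (norm_nonneg _))
    linarith
  rw [← sub_eq_zero, ← norm_le_zero_iff]
  refine le_of_forall_pos_le_add fun ε hε => ?_
  have hS : (0:ℝ) < 2 * ‖S‖ + 1 := by positivity
  have := key (ε / (2 * ‖S‖ + 1)) (by positivity)
  refine this.trans ?_
  rw [zero_add, mul_div_assoc', div_le_iff₀ hS]
  nlinarith

theorem cfc_apply_of_apply_eq_smul {a : H →L[ℂ] H} (ha : IsSelfAdjoint a) {v : H} {l : ℝ}
    (hv : a v = (l : ℂ) • v) {g : ℝ → ℝ} (hg : Continuous g) :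
    cfc g a v = (g l : ℂ) • v := by
  by_cases h0 : v = 0
  · simp [h0]
  set S : H →L[ℂ] H := (innerSL ℂ v).smulRight v with hS
  have h1 : a * S = S * algebraMap ℝ (H →L[ℂ] H) l := by
    ext x
    simp only [hS, mul_apply_eq_comp, smulRight_apply, innerSL_apply_apply, map_smul, hv,
      Algebra.algebraMap_eq_smul_one, smul_apply, one_apply_eq_self, smul_smul]
    rw [← Complex.coe_smul, inner_smul_right, mul_comm]
  have h2 := cfc_mul_eq_mul_cfc_of_mul_eq ha (IsSelfAdjoint.algebraMap _ (.all l)) h1 hg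
  rw [cfc_algebraMap] at h2
  have h3 := congrArg (fun A : H →L[ℂ] H => A v) h2
  have h4 : (⟪v, v⟫ : ℂ) ≠ 0 := inner_self_ne_zero.mpr h0
  have h5 : ⟪v, v⟫ • cfc g a v = ⟪v, v⟫ • ((g l : ℂ) • v) := by
    simp only [hS, mul_apply_eq_comp, smulRight_apply, innerSL_apply_apply, map_smul,
      Algebra.algebraMap_eq_smul_one, smul_apply, one_apply_eq_self] at h3
    rw [h3, ← Complex.coe_smul, inner_smul_right, smul_smul, mul_comm]
  exact smul_right_injective _ h4 h5

theorem continuous_rpow_half {p : ℝ} (hp : 0 ≤ p) : Continuous fun t : ℝ => t ^ (p / 2) :=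
  Real.continuous_rpow_const (by positivity)

theorem absPow_eq (T : H →L[ℂ] H) (p : ℝ) :
    absPow T p = cfc (fun t : ℝ => t ^ (p / 2)) (star T * T) := rfl

theorem absPow_adjoint_eq (T : H →L[ℂ] H) (p : ℝ) :
    absPow (adjoint T) p = cfc (fun t : ℝ => t ^ (p / 2)) (T * star T) := by
  rw [absPow_eq, ← star_eq_adjoint, star_star]

theorem absPow_nonneg (T : H →L[ℂ] H) (p : ℝ) : 0 ≤ absPow T p :=
  cfc_nonneg fun _ ht => Real.rpow_nonneg (spectrum_nonneg_of_nonneg (star_mul_self_nonneg T) ht) _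

omit [CompleteSpace H] in
theorem re_inner_mono {A B : H →L[ℂ] H} (h : A ≤ B) (x : H) :
    RCLike.re ⟪x, A x⟫ ≤ RCLike.re ⟪x, B x⟫ := by
  have := (ContinuousLinearMap.le_def A B).mp h
  have := this.re_inner_nonneg_right x
  simpa [inner_sub_right] using this

omit [CompleteSpace H] in
theorem re_inner_nonneg_of_nonneg {A : H →L[ℂ] H} (h : 0 ≤ A) (x : H) :
    0 ≤ RCLike.re ⟪x, A x⟫ := by
  simpa using re_inner_mono h x

theorem re_inner_star_mul_self (B : H →L[ℂ] H) (x : H) :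
    RCLike.re ⟪x, (star B * B) x⟫ = ‖B x‖ ^ 2 := by
  rw [mul_apply_eq_comp, star_eq_adjoint, adjoint_inner_right]
  exact inner_self_eq_norm_sq _

theorem mul_cfc_mul_star (T : H →L[ℂ] H) {k : ℝ → ℝ} (hk : Continuous k) :
    star (cfc k (star T * T) * star T) * (cfc k (star T * T) * star T) =
      cfc (fun t => k t ^ 2 * t) (T * star T) := by
  have ha : IsSelfAdjoint (star T * T) := .star_mul_self T
  have hb : IsSelfAdjoint (T * star T) := .mul_star_self T
  have h := cfc_mul_eq_mul_cfc_of_mul_eq hb ha (mul_assoc T (star T) T)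
    (g := fun t => k t ^ 2) (hk.pow 2)
  have hs : star (cfc k (star T * T)) = cfc k (star T * T) := (cfc_predicate k (star T * T)).star_eq
  rw [star_mul, star_star, hs, cfc_mul (fun t => k t ^ 2) (fun t => t) _
    (hk.pow 2).continuousOn continuousOn_id, cfc_id' ℝ (T * star T), ← mul_assoc _ T, h]
  rw [cfc_pow k 2 _ hk.continuousOn, pow_two]
  simp only [mul_assoc]

theorem cfc_mul_star_mul_cfc (T : H →L[ℂ] H) {k : ℝ → ℝ} (hk : Continuous k) :
    (cfc k (star T * T) * star T) * star (cfc k (star T * T) * star T) =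
      cfc (fun t => k t ^ 2 * t) (star T * T) := by
  have ha : IsSelfAdjoint (star T * T) := .star_mul_self T
  have hs : star (cfc k (star T * T)) = cfc k (star T * T) := (cfc_predicate k (star T * T)).star_eq
  have hc : cfc k (star T * T) * (star T * T) = (star T * T) * cfc k (star T * T) :=
    cfc_mul_eq_mul_cfc_of_mul_eq ha ha rfl hk
  rw [star_mul, star_star, hs, cfc_mul (fun t => k t ^ 2) (fun t => t) _
    (hk.pow 2).continuousOn continuousOn_id, cfc_id' ℝ (star T * T),
    cfc_pow k 2 _ hk.continuousOn, pow_two, mul_assoc, mul_assoc, hc]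
  simp only [mul_assoc]

omit [CompleteSpace H] in
theorem re_inner_add_algebraMap (A : H →L[ℂ] H) (c : ℝ) (x : H) :
    RCLike.re ⟪x, (A + algebraMap ℝ _ c) x⟫ = RCLike.re ⟪x, A x⟫ + c * ‖x‖ ^ 2 := by
  rw [add_apply, inner_add_right, map_add, Algebra.algebraMap_eq_smul_one, smul_apply,
    one_apply_eq_self, ← Complex.coe_smul, inner_smul_right, RCLike.re_to_complex,
    RCLike.re_to_complex, Complex.re_ofReal_mul, ← RCLike.re_to_complex, ← RCLike.re_to_complex,
    inner_self_eq_norm_sq]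

omit [CompleteSpace H] in
theorem re_inner_real_smul_apply (r : ℝ) (A : H →L[ℂ] H) (x : H) :
    RCLike.re ⟪x, (r • A) x⟫ = r * RCLike.re ⟪x, A x⟫ := by
  rw [smul_apply, ← Complex.coe_smul, inner_smul_right, RCLike.re_to_complex,
    RCLike.re_to_complex, Complex.re_ofReal_mul]

theorem norm_inner_sq_le_absPow_one (T : H →L[ℂ] H) (x y : H) :
    ‖⟪x, T y⟫‖ ^ 2 ≤
      RCLike.re ⟪x, absPow (adjoint T) 1 x⟫ * RCLike.re ⟪y, absPow T 1 y⟫ := by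
  set a := star T * T
  have ha0 : 0 ≤ a := star_mul_self_nonneg T
  have hb0 : 0 ≤ T * star T := mul_star_self_nonneg T
  set X := RCLike.re ⟪x, absPow (adjoint T) 1 x⟫
  set Y := RCLike.re ⟪y, absPow T 1 y⟫
  have hX : 0 ≤ X := re_inner_nonneg_of_nonneg (absPow_nonneg _ _) _
  have key : ∀ δ > 0, ‖⟪x, T y⟫‖ ^ 2 ≤ X * (Y + δ * ‖y‖ ^ 2) := by
    intro δ hδ
    have hpos : ∀ t : ℝ, 0 < √|t| + δ := fun t => by positivity
    have hlc : Continuous fun t : ℝ => √(√|t| + δ) := by fun_prop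
    have hkc : Continuous fun t : ℝ => (√(√|t| + δ))⁻¹ :=
      hlc.inv₀ fun t => (Real.sqrt_pos.mpr (hpos t)).ne'
    set L := cfc (fun t : ℝ => √(√|t| + δ)) a
    set K := cfc (fun t : ℝ => (√(√|t| + δ))⁻¹) a
    have hKs : star K = K := (cfc_predicate _ a : IsSelfAdjoint K).star_eq
    have hLs : star L = L := (cfc_predicate _ a : IsSelfAdjoint L).star_eq
    have hKL : K * L = 1 := by
      rw [← cfc_mul _ _ _ hkc.continuousOn hlc.continuousOn, ← cfc_one ℝ a]
      exact cfc_congr fun t _ => inv_mul_cancel₀ (Real.sqrt_pos.mpr (hpos t)).ne'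
    have h1 : ⟪x, T y⟫ = ⟪(K * star T) x, L y⟫ := by
      have : y = K (L y) := by
        rw [← mul_apply_eq_comp, hKL, one_apply_eq_self]
      conv_lhs => rw [this]
      rw [mul_apply_eq_comp, ← adjoint_inner_right, ← star_eq_adjoint K, hKs, star_eq_adjoint,
        adjoint_inner_left]
    have h2 : ‖(K * star T) x‖ ^ 2 ≤ X := by
      rw [← re_inner_star_mul_self, mul_cfc_mul_star T hkc]
      refine re_inner_mono ?_ x
      rw [absPow_adjoint_eq]
      refine cfc_mono (fun t ht => ?_) ((hkc.pow 2).mul continuous_id).continuousOn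
        (continuous_rpow_half zero_le_one).continuousOn
      have ht := spectrum_nonneg_of_nonneg hb0 ht
      rw [inv_pow, Real.sq_sqrt (hpos t).le, abs_of_nonneg ht, ← Real.sqrt_eq_rpow,
        inv_mul_eq_div, div_le_iff₀ (by positivity)]
      nlinarith [Real.mul_self_sqrt ht, Real.sqrt_nonneg t, mul_nonneg (Real.sqrt_nonneg t) hδ.le]
    have h3 : ‖L y‖ ^ 2 = Y + δ * ‖y‖ ^ 2 := by
      rw [← re_inner_star_mul_self, hLs, ← cfc_mul _ _ _ hlc.continuousOn hlc.continuousOn]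
      have : cfc (fun t : ℝ => √(√|t| + δ) * √(√|t| + δ)) a = absPow T 1 + algebraMap ℝ _ δ := by
        rw [absPow_eq, ← cfc_add_const δ _ _ (continuous_rpow_half zero_le_one).continuousOn]
        refine cfc_congr fun t ht => ?_
        have ht := spectrum_nonneg_of_nonneg ha0 ht
        rw [Real.mul_self_sqrt (hpos t).le, abs_of_nonneg ht, ← Real.sqrt_eq_rpow]
      rw [this, re_inner_add_algebraMap]
    rw [h1, ← h3]
    calc ‖⟪(K * star T) x, L y⟫‖ ^ 2 ≤ (‖(K * star T) x‖ * ‖L y‖) ^ 2 :=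
          pow_le_pow_left₀ (norm_nonneg _) (norm_inner_le_norm _ _) 2
      _ = ‖(K * star T) x‖ ^ 2 * ‖L y‖ ^ 2 := mul_pow _ _ _
      _ ≤ X * ‖L y‖ ^ 2 := by gcongr
  have hlim : Tendsto (fun δ : ℝ => X * (Y + δ * ‖y‖ ^ 2)) (𝓝[>] 0) (𝓝 (X * Y)) := by
    have : Continuous fun δ : ℝ => X * (Y + δ * ‖y‖ ^ 2) := by fun_prop
    simpa using (this.tendsto 0).mono_left nhdsWithin_le_nhds
  exact ge_of_tendsto hlim (eventually_mem_nhdsWithin.mono key)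

theorem re_inner_absPow_one_rpow_le (T : H →L[ℂ] H) {p : ℝ} (hp : 1 ≤ p) {y : H}
    (hy : ‖y‖ ≤ 1) :
    RCLike.re ⟪y, absPow T 1 y⟫ ^ p ≤ RCLike.re ⟪y, absPow T p y⟫ := by
  set c := RCLike.re ⟪y, absPow T 1 y⟫ with hc
  have hc0 : 0 ≤ c := re_inner_nonneg_of_nonneg (absPow_nonneg _ _) _
  rcases hc0.eq_or_lt with h | h
  · rw [← h, Real.zero_rpow (by linarith)]
    exact re_inner_nonneg_of_nonneg (absPow_nonneg _ _) _
  have h1 : (c ^ p * p / c) • absPow T 1 + algebraMap ℝ _ (c ^ p * (1 - p)) ≤ absPow T p := by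
    rw [absPow_eq, absPow_eq, ← cfc_const_mul _ _ _ (continuous_rpow_half zero_le_one).continuousOn,
      ← cfc_add_const _ (fun t : ℝ => c ^ p * p / c * t ^ (1 / 2 : ℝ)) _
        (continuous_const.mul (continuous_rpow_half zero_le_one)).continuousOn]
    refine cfc_mono (fun t ht => ?_)
      ((continuous_const.mul (continuous_rpow_half zero_le_one)).add continuous_const).continuousOn
      (continuous_rpow_half (by linarith)).continuousOn
    have ht := spectrum_nonneg_of_nonneg (star_mul_self_nonneg T) ht
    have hs : 0 ≤ t ^ (1 / 2 : ℝ) := by positivity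
    have hB := one_add_mul_self_le_rpow_one_add (s := t ^ (1 / 2 : ℝ) / c - 1)
      (by have : 0 ≤ t ^ (1 / 2 : ℝ) / c := by positivity
          linarith) hp
    rw [add_sub_cancel, Real.div_rpow hs hc0, ← Real.rpow_mul ht,
      show (1 / 2 : ℝ) * p = p / 2 by ring, le_div_iff₀ (by positivity)] at hB
    refine le_trans (le_of_eq ?_) hB
    field_simp
    ring
  have h2 := re_inner_mono h1 y
  refine le_trans ?_ h2
  have h3 : RCLike.re ⟪y, ((c ^ p * p / c) • absPow T 1 +
      algebraMap ℝ (H →L[ℂ] H) (c ^ p * (1 - p))) y⟫ =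
      c ^ p * p / c * c + c ^ p * (1 - p) * ‖y‖ ^ 2 := by
    rw [re_inner_add_algebraMap, re_inner_real_smul_apply]
  rw [h3, div_mul_cancel₀ _ h.ne']
  have h4 : 0 ≤ c ^ p * (p - 1) := mul_nonneg (by positivity) (by linarith)
  have h5 : ‖y‖ ^ 2 ≤ 1 := pow_le_one₀ (norm_nonneg _) hy
  nlinarith

theorem norm_inner_rpow_le (T : H →L[ℂ] H) {p : ℝ} (hp : 1 ≤ p) {x y : H}
    (hx : ‖x‖ ≤ 1) (hy : ‖y‖ ≤ 1) :
    ‖⟪x, T y⟫‖ ^ p ≤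
      √(RCLike.re ⟪x, absPow (adjoint T) p x⟫) * √(RCLike.re ⟪y, absPow T p y⟫) := by
  have hX := re_inner_nonneg_of_nonneg (absPow_nonneg (adjoint T) 1) x
  have hY := re_inner_nonneg_of_nonneg (absPow_nonneg T 1) y
  rw [← Real.sqrt_mul (re_inner_nonneg_of_nonneg (absPow_nonneg _ _) _)]
  refine Real.le_sqrt_of_sq_le ?_
  rw [← Real.rpow_mul_natCast (norm_nonneg _), mul_comm p, Real.rpow_natCast_mul (norm_nonneg _)]
  calc (‖⟪x, T y⟫‖ ^ 2) ^ p ≤ (RCLike.re ⟪x, absPow (adjoint T) 1 x⟫ *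
        RCLike.re ⟪y, absPow T 1 y⟫) ^ p :=
        Real.rpow_le_rpow (by positivity) (norm_inner_sq_le_absPow_one T x y) (by linarith)
    _ = _ := Real.mul_rpow hX hY
    _ ≤ _ := mul_le_mul (re_inner_absPow_one_rpow_le _ hp hx) (re_inner_absPow_one_rpow_le _ hp hy)
        (by positivity) (re_inner_nonneg_of_nonneg (absPow_nonneg _ _) _)

omit [CompleteSpace H] in
theorem tsum_enorm_inner_sq (f : HilbertBasis ℕ ℂ H) (x : H) :
    ∑' i, ‖⟪f i, x⟫‖ₑ ^ 2 = ‖x‖ₑ ^ 2 := by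
  have h := f.hasSum_inner_mul_inner x x
  have h1 : HasSum (fun i => ‖⟪f i, x⟫‖ ^ 2) (‖x‖ ^ 2) := by
    have h2 := RCLike.hasSum_re ℂ h
    rw [inner_self_eq_norm_sq] at h2
    convert h2 using 2 with i
    rw [← inner_conj_symm x (f i), RCLike.conj_mul]
    norm_cast
  have h3 : ∀ z : H, ‖z‖ₑ ^ 2 = ENNReal.ofReal (‖z‖ ^ 2) := fun z => by
    rw [ENNReal.ofReal_pow (norm_nonneg _), ofReal_norm]
  have h4 : ∀ z : ℂ, ‖z‖ₑ ^ 2 = ENNReal.ofReal (‖z‖ ^ 2) := fun z => by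
    rw [ENNReal.ofReal_pow (norm_nonneg _), ofReal_norm]
  simp_rw [h3, h4]
  rw [← h1.tsum_eq, ENNReal.ofReal_tsum_of_nonneg (fun _ => by positivity) h1.summable]

theorem ofReal_re_inner_star_mul_self (B : H →L[ℂ] H) (x : H) :
    ENNReal.ofReal (RCLike.re ⟪x, (star B * B) x⟫) = ‖B x‖ₑ ^ 2 := by
  rw [re_inner_star_mul_self, ENNReal.ofReal_pow (norm_nonneg _), ofReal_norm]

omit [CompleteSpace H] in
theorem posTr_mono (f : HilbertBasis ℕ ℂ H) {A B : H →L[ℂ] H} (h : A ≤ B) :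
    posTr f A ≤ posTr f B :=
  ENNReal.tsum_le_tsum fun _ => ENNReal.ofReal_le_ofReal (re_inner_mono h _)

theorem posTr_star_mul_self (f : HilbertBasis ℕ ℂ H) (B : H →L[ℂ] H) :
    posTr f (star B * B) = ∑' i, ‖B (f i)‖ₑ ^ 2 :=
  tsum_congr fun _ => ofReal_re_inner_star_mul_self B _

theorem enorm_inner_apply_eq (B : H →L[ℂ] H) (x y : H) :
    ‖⟪y, B x⟫‖ₑ = ‖⟪x, star B y⟫‖ₑ := by
  rw [star_eq_adjoint, adjoint_inner_right, ← inner_conj_symm, ← ofReal_norm, RCLike.norm_conj,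
    ofReal_norm]

theorem posTr_star_mul_self_comm (f : HilbertBasis ℕ ℂ H) (B : H →L[ℂ] H) :
    posTr f (star B * B) = posTr f (B * star B) := by
  conv_rhs => rw [← star_star B, star_star (star B)]
  rw [posTr_star_mul_self, posTr_star_mul_self]
  simp_rw [← tsum_enorm_inner_sq f (_ : H)]
  rw [ENNReal.tsum_comm]
  simp_rw [enorm_inner_apply_eq B]

theorem Orthonormal.sum_ofReal_re_inner_le {ι : Type*} [Fintype ι] {u : ι → H}
    (hu : Orthonormal ℂ u) (f : HilbertBasis ℕ ℂ H) {A : H →L[ℂ] H} (hA : 0 ≤ A) :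
    ∑ k, ENNReal.ofReal (RCLike.re ⟪u k, A (u k)⟫) ≤ posTr f A := by
  obtain ⟨B, rfl⟩ := CStarAlgebra.nonneg_iff_eq_star_mul_self.mp hA
  simp_rw [ofReal_re_inner_star_mul_self]
  rw [posTr_star_mul_self_comm, ← star_star B, star_star (star B), posTr_star_mul_self]
  simp_rw [← tsum_enorm_inner_sq f (star (star B) _), enorm_inner_apply_eq (star (star B)),
    star_star]
  rw [← tsum_fintype (L := .unconditional _), ENNReal.tsum_comm]
  refine ENNReal.tsum_le_tsum fun i => ?_
  rw [tsum_fintype]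
  have h := hu.sum_inner_products_le (star B (f i)) (s := Finset.univ)
  rw [← ofReal_norm, ← ENNReal.ofReal_pow (norm_nonneg _)]
  refine le_trans (le_of_eq ?_) (ENNReal.ofReal_le_ofReal h)
  rw [ENNReal.ofReal_sum_of_nonneg fun _ _ => by positivity]
  exact Finset.sum_congr rfl fun k _ => by rw [ENNReal.ofReal_pow (norm_nonneg _), ofReal_norm]

theorem trAbsPow_adjoint_le (f : HilbertBasis ℕ ℂ H) (T : H →L[ℂ] H) {p : ℝ} (hp : 1 ≤ p) :
    trAbsPow f (adjoint T) p ≤ trAbsPow f T p := by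
  by_cases hfin : trAbsPow f T p = ⊤
  · simp [hfin]
  have ha0 : 0 ≤ star T * T := star_mul_self_nonneg T
  have hb0 : 0 ≤ T * star T := mul_star_self_nonneg T
  obtain ⟨M, hM0, hM⟩ : ∃ M : ℝ, 0 ≤ M ∧
      ∀ t ∈ spectrum ℝ (T * star T), |t| ^ ((p - 1) / 2) ≤ M := by
    have hc : IsCompact (spectrum ℝ (T * star T)) := ContinuousFunctionalCalculus.isCompact_spectrum _
    obtain ⟨M, hM⟩ := hc.exists_bound_of_continuousOn (f := fun t : ℝ => |t| ^ ((p - 1) / 2))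
      (continuous_abs.rpow_const fun _ => .inr (by linarith)).continuousOn
    exact ⟨max M 0, le_max_right _ _, fun t ht =>
      (le_abs_self _).trans ((hM t ht).trans (le_max_left _ _))⟩
  have key : ∀ (s : Finset ℕ), ∀ δ > 0,
      ∑ i ∈ s, RCLike.re ⟪f i, absPow (adjoint T) p (f i)⟫ ≤
        (trAbsPow f T p).toReal + s.card * (M * δ) := by
    intro s δ hδ
    have hpos : ∀ t : ℝ, 0 < √|t| + δ := fun t => by positivity
    have hkc : Continuous fun t : ℝ => √(|t| ^ ((p - 1) / 2) / (√|t| + δ)) := by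
      refine Real.continuous_sqrt.comp (Continuous.div
        (continuous_abs.rpow_const fun _ => .inr (by linarith)) (by fun_prop)
        fun t => (hpos t).ne')
    set k := fun t : ℝ => √(|t| ^ ((p - 1) / 2) / (√|t| + δ)) with hk
    have hk2 : ∀ t, 0 ≤ t → k t ^ 2 * t = t ^ ((p - 1) / 2) * t / (√t + δ) := by
      intro t ht
      rw [hk]
      simp only
      rw [Real.sq_sqrt (by positivity), abs_of_nonneg ht]
      ring
    have hpow : ∀ t : ℝ, 0 ≤ t → t ^ (p / 2) = t ^ ((p - 1) / 2) * √t := by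
      intro t ht
      rw [Real.sqrt_eq_rpow, ← Real.rpow_add_of_nonneg ht (by linarith) (by norm_num)]
      ring_nf
    have hk2c : Continuous fun t => k t ^ 2 * t := (hkc.pow 2).mul continuous_id
    have hpc := continuous_rpow_half (p := p) (by linarith)
    have h1 : posTr f (cfc (fun t => k t ^ 2 * t) (T * star T)) ≤ trAbsPow f T p := by
      rw [← mul_cfc_mul_star T hkc, posTr_star_mul_self_comm, cfc_mul_star_mul_cfc T hkc]
      refine posTr_mono f (cfc_mono (fun t ht => ?_) hk2c.continuousOn hpc.continuousOn)
      have ht := spectrum_nonneg_of_nonneg ha0 ht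
      rw [hk2 t ht, hpow t ht, mul_div_assoc]
      gcongr
      rw [div_le_iff₀ (by positivity)]
      nlinarith [Real.mul_self_sqrt ht, mul_nonneg (Real.sqrt_nonneg t) hδ.le]
    have h2 : absPow (adjoint T) p ≤
        cfc (fun t => k t ^ 2 * t) (T * star T) + algebraMap ℝ _ (M * δ) := by
      rw [absPow_adjoint_eq, ← cfc_add_const _ _ _ hk2c.continuousOn]
      refine cfc_mono (fun t ht => ?_) hpc.continuousOn
        (hk2c.add continuous_const).continuousOn
      have hMt := hM t ht
      have ht := spectrum_nonneg_of_nonneg hb0 ht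
      rw [hk2 t ht, hpow t ht]
      rw [abs_of_nonneg ht] at hMt
      have h3 : t ^ ((p - 1) / 2) * √t = t ^ ((p - 1) / 2) * t / (√t + δ) +
          t ^ ((p - 1) / 2) * (√t / (√t + δ)) * δ := by
        have := Real.mul_self_sqrt ht
        have h4 : √t + δ ≠ 0 := by positivity
        field_simp
        rw [← this]
        ring_nf
        rw [Real.sqrt_sq (Real.sqrt_nonneg _)]
        ring
      rw [h3]
      gcongr
      refine (mul_le_of_le_one_right (by positivity) ?_).trans hMt
      rw [div_le_one (by positivity)]
      linarith
    have hnn : 0 ≤ cfc (fun t => k t ^ 2 * t) (T * star T) :=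
      cfc_nonneg fun t ht => mul_nonneg (sq_nonneg _) (spectrum_nonneg_of_nonneg hb0 ht)
    calc ∑ i ∈ s, RCLike.re ⟪f i, absPow (adjoint T) p (f i)⟫
        ≤ ∑ i ∈ s, (RCLike.re ⟪f i, cfc (fun t => k t ^ 2 * t) (T * star T) (f i)⟫ + M * δ) := by
          refine Finset.sum_le_sum fun i _ => (re_inner_mono h2 (f i)).trans (le_of_eq ?_)
          rw [re_inner_add_algebraMap, f.orthonormal.1 i, one_pow, mul_one]
      _ = ∑ i ∈ s, RCLike.re ⟪f i, cfc (fun t => k t ^ 2 * t) (T * star T) (f i)⟫ +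
          s.card * (M * δ) := by simp [Finset.sum_add_distrib]
      _ ≤ _ := by
          gcongr
          rw [← ENNReal.ofReal_le_iff_le_toReal hfin, ENNReal.ofReal_sum_of_nonneg
            fun i _ => re_inner_nonneg_of_nonneg hnn _]
          exact (ENNReal.sum_le_tsum s).trans h1
  refine ENNReal.summable.tsum_le_of_sum_le fun s => ?_
  rw [← ENNReal.ofReal_sum_of_nonneg fun i _ => re_inner_nonneg_of_nonneg (absPow_nonneg _ _) _,
    ENNReal.ofReal_le_iff_le_toReal hfin]
  have hlim : Tendsto (fun δ : ℝ => (trAbsPow f T p).toReal + s.card * (M * δ)) (𝓝[>] 0)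
      (𝓝 (trAbsPow f T p).toReal) := by
    have : Continuous fun δ : ℝ => (trAbsPow f T p).toReal + s.card * (M * δ) := by fun_prop
    simpa using (this.tendsto 0).mono_left nhdsWithin_le_nhds
  exact ge_of_tendsto hlim (eventually_mem_nhdsWithin.mono (key s))

/-- The orthogonal projection onto the span of the basis vectors `f i`, `i ∈ s`. -/
def basisProj (f : HilbertBasis ℕ ℂ H) (s : Finset ℕ) : H →L[ℂ] H :=
  ∑ i ∈ s, (innerSL ℂ (f i)).smulRight (f i)

omit [CompleteSpace H] in
theorem basisProj_apply (f : HilbertBasis ℕ ℂ H) (s : Finset ℕ) (x : H) :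
    basisProj f s x = ∑ i ∈ s, ⟪f i, x⟫ • f i := by
  simp [basisProj, sum_apply]

omit [CompleteSpace H] in
theorem basisProj_apply_basis (f : HilbertBasis ℕ ℂ H) (s : Finset ℕ) (j : ℕ) :
    basisProj f s (f j) = if j ∈ s then f j else 0 := by
  simp [basisProj_apply, orthonormal_iff_ite.mp f.orthonormal]

omit [CompleteSpace H] in
theorem basisProj_mul (f : HilbertBasis ℕ ℂ H) (s t : Finset ℕ) :
    basisProj f s * basisProj f t = basisProj f (s ∩ t) := by
  ext x
  rw [mul_apply_eq_comp, basisProj_apply f t, map_sum, basisProj_apply, Finset.inter_comm,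
    ← Finset.filter_mem_eq_inter, Finset.sum_filter]
  refine Finset.sum_congr rfl fun i _ => ?_
  rw [map_smul, basisProj_apply_basis]
  split_ifs <;> simp

omit [CompleteSpace H] in
theorem inner_basisProj_left (f : HilbertBasis ℕ ℂ H) (s : Finset ℕ) (x y : H) :
    ⟪basisProj f s x, y⟫ = ⟪x, basisProj f s y⟫ := by
  simp only [basisProj_apply, sum_inner, inner_sum, inner_smul_left, inner_smul_right,
    inner_conj_symm]
  exact Finset.sum_congr rfl fun _ _ => mul_comm _ _

theorem star_basisProj (f : HilbertBasis ℕ ℂ H) (s : Finset ℕ) :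
    star (basisProj f s) = basisProj f s := by
  rw [star_eq_adjoint]
  exact ((eq_adjoint_iff _ _).mpr fun x y => inner_basisProj_left f s x y).symm

omit [CompleteSpace H] in
theorem norm_basisProj_apply_le (f : HilbertBasis ℕ ℂ H) (s : Finset ℕ) (x : H) :
    ‖basisProj f s x‖ ≤ ‖x‖ := by
  have hidem : basisProj f s (basisProj f s x) = basisProj f s x := by
    rw [← mul_apply_eq_comp, basisProj_mul, Finset.inter_self]
  have h : ‖basisProj f s x‖ * ‖basisProj f s x‖ ≤ ‖x‖ * ‖basisProj f s x‖ := by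
    rw [← inner_self_eq_norm_mul_norm (𝕜 := ℂ), inner_basisProj_left, hidem]
    exact re_inner_le_norm _ _
  by_cases h0 : ‖basisProj f s x‖ = 0
  · rw [h0]; exact norm_nonneg _
  · exact le_of_mul_le_mul_right h (lt_of_le_of_ne (norm_nonneg _) (Ne.symm h0))

theorem posTr_basisProj_conj (f : HilbertBasis ℕ ℂ H) (s : Finset ℕ) (A : H →L[ℂ] H) :
    posTr f (star (basisProj f s) * A * basisProj f s) =
      ∑ i ∈ s, ENNReal.ofReal (RCLike.re ⟪f i, A (f i)⟫) := by
  rw [posTr, tsum_eq_sum (s := s)]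
  · refine Finset.sum_congr rfl fun i hi => ?_
    rw [star_basisProj, mul_apply_eq_comp, mul_apply_eq_comp, ← inner_basisProj_left,
      basisProj_apply_basis, if_pos hi]
  · intro i hi
    rw [mul_apply_eq_comp, basisProj_apply_basis, if_neg hi]
    simp

theorem Orthonormal.sum_re_inner_basisProj_le {ι : Type*} [Fintype ι] {u : ι → H}
    (hu : Orthonormal ℂ u) (f : HilbertBasis ℕ ℂ H) (s : Finset ℕ) {A : H →L[ℂ] H}
    (hA : 0 ≤ A) :
    ∑ k, RCLike.re ⟪basisProj f s (u k), A (basisProj f s (u k))⟫ ≤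
      ∑ i ∈ s, RCLike.re ⟪f i, A (f i)⟫ := by
  have hnn := re_inner_nonneg_of_nonneg hA
  rw [← ENNReal.ofReal_le_ofReal_iff (Finset.sum_nonneg fun _ _ => hnn _),
    ENNReal.ofReal_sum_of_nonneg fun _ _ => hnn _, ENNReal.ofReal_sum_of_nonneg fun _ _ => hnn _,
    ← posTr_basisProj_conj]
  have := hu.sum_ofReal_re_inner_le f (star_left_conjugate_nonneg hA (basisProj f s))
  refine le_trans (le_of_eq (Finset.sum_congr rfl fun k _ => ?_)) this
  rw [star_basisProj, mul_apply_eq_comp, mul_apply_eq_comp, ← inner_basisProj_left]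

omit [CompleteSpace H] in
theorem sum_re_inner_le_toReal_posTr (f : HilbertBasis ℕ ℂ H) (s : Finset ℕ) {A : H →L[ℂ] H}
    (hA : 0 ≤ A) (hfin : posTr f A ≠ ⊤) :
    ∑ i ∈ s, RCLike.re ⟪f i, A (f i)⟫ ≤ (posTr f A).toReal := by
  rw [← ENNReal.ofReal_le_iff_le_toReal hfin,
    ENNReal.ofReal_sum_of_nonneg fun _ _ => re_inner_nonneg_of_nonneg hA _]
  exact ENNReal.sum_le_tsum s

theorem trAbsPow_eq_sum (f : HilbertBasis ℕ ℂ H) {p : ℝ} (hp : 1 ≤ p) {D : H →L[ℂ] H} {m : ℕ}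
    (hD : D * basisProj f (Finset.range m) = D) :
    trAbsPow f D p =
      ENNReal.ofReal (∑ i ∈ Finset.range m, RCLike.re ⟪f i, absPow D p (f i)⟫) := by
  rw [ENNReal.ofReal_sum_of_nonneg fun _ _ => re_inner_nonneg_of_nonneg (absPow_nonneg _ _) _,
    trAbsPow, posTr, tsum_eq_sum]
  intro i hi
  have h1 : D (f i) = 0 := by
    rw [← hD, mul_apply_eq_comp, basisProj_apply_basis, if_neg hi, map_zero]
  have h2 : absPow D p (f i) = 0 := by
    rw [absPow_eq, cfc_apply_of_apply_eq_smul (l := 0) (.star_mul_self D)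
      (by rw [mul_apply_eq_comp, h1]; simp) (continuous_rpow_half (by linarith)),
      Real.zero_rpow (by linarith)]
    simp
  rw [h2]; simp

/-- Diagonalization of `D* D` when `D` only sees the span of `f 0, …, f (m - 1)`. -/
theorem exists_orthonormal_eigenvectors (f : HilbertBasis ℕ ℂ H) {D : H →L[ℂ] H} {m : ℕ}
    (hD : D * basisProj f (Finset.range m) = D) :
    ∃ (v : Fin m → H) (l : Fin m → ℝ), Orthonormal ℂ v ∧
      (∀ k, (star D * D) (v k) = (l k : ℂ) • v k) ∧
      ∀ A : H →L[ℂ] H, ∑ i ∈ Finset.range m, ⟪f i, A (f i)⟫ = ∑ k, ⟪v k, A (v k)⟫ := by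
  let e := EuclideanSpace.basisFun (Fin m) ℂ
  have hg : Orthonormal ℂ fun i : Fin m => f i := f.orthonormal.comp _ Fin.val_injective
  let J₀ : EuclideanSpace ℂ (Fin m) →ₗ[ℂ] H := e.toBasis.constr ℂ fun i : Fin m => f i
  have hJe : ∀ i, J₀ (e i) = f i := fun i => by
    have := e.toBasis.constr_basis ℂ (fun i : Fin m => f i) i
    rwa [e.coe_toBasis] at this
  let J : EuclideanSpace ℂ (Fin m) →ₗᵢ[ℂ] H := J₀.isometryOfOrthonormal (v := e.toBasis)
    (by rw [e.coe_toBasis]; exact e.orthonormal)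
    (by rw [e.coe_toBasis]; convert hg using 1; exact funext hJe)
  have hJ : ∀ i, J (e i) = f i := hJe
  let Jc := J.toContinuousLinearMap
  have hJJ : ∀ x, Jc (adjoint Jc x) = basisProj f (Finset.range m) x := by
    intro x
    rw [basisProj_apply, Finset.sum_range fun i => ⟪f i, x⟫ • f i, ← e.sum_repr (adjoint Jc x),
      map_sum]
    refine Finset.sum_congr rfl fun i _ => ?_
    rw [map_smul, e.repr_apply_apply, adjoint_inner_right]
    exact congrArg₂ _ (congrArg (fun z => ⟪z, x⟫) (hJ i)) (hJ i)
  let comp (A : H →L[ℂ] H) : EuclideanSpace ℂ (Fin m) →ₗ[ℂ] EuclideanSpace ℂ (Fin m) :=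
    (adjoint Jc ∘L A ∘L Jc : EuclideanSpace ℂ (Fin m) →L[ℂ] EuclideanSpace ℂ (Fin m))
  have hcomp : ∀ A x y, ⟪x, comp A y⟫ = ⟪J x, A (J y)⟫ := fun A x y =>
    adjoint_inner_right Jc x (A (Jc y))
  have hsymm : (comp (star D * D)).IsSymmetric := by
    intro x y
    rw [hcomp, ← inner_conj_symm, hcomp, inner_conj_symm, star_eq_adjoint, mul_apply_eq_comp,
      mul_apply_eq_comp, adjoint_inner_left, adjoint_inner_right]
  have hrank : Module.finrank ℂ (EuclideanSpace ℂ (Fin m)) = m := by simp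
  let w := hsymm.eigenvectorBasis hrank
  refine ⟨fun k => J (w k), hsymm.eigenvalues hrank, w.orthonormal.comp_linearIsometry J, ?_, ?_⟩
  · intro k
    have h1 := congrArg Jc (hsymm.apply_eigenvectorBasis hrank k)
    have h2 : basisProj f (Finset.range m) * (star D * D) = star D * D := by
      have := congrArg star hD
      rw [star_mul, star_basisProj] at this
      rw [← mul_assoc, this]
    rw [map_smul] at h1
    refine Eq.trans ?_ h1
    refine Eq.trans ?_ (hJJ ((star D * D) (Jc (w k)))).symm
    rw [← mul_apply_eq_comp (basisProj f (Finset.range m)), h2]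
    rfl
  · intro A
    rw [Finset.sum_range fun i => ⟪f i, A (f i)⟫]
    simp_rw [← hJ, ← hcomp]
    rw [← LinearMap.trace_eq_sum_inner, ← LinearMap.trace_eq_sum_inner]

theorem exists_orthonormal_toReal_trAbsPow_eq (f : HilbertBasis ℕ ℂ H) {p : ℝ} (hp : 1 ≤ p)
    {D : H →L[ℂ] H} {m : ℕ} (hD : D * basisProj f (Finset.range m) = D) :
    ∃ (ι : Type) (_ : Fintype ι) (u v : ι → H), Orthonormal ℂ u ∧ Orthonormal ℂ v ∧
      (trAbsPow f D p).toReal = ∑ k, ‖⟪u k, D (v k)⟫‖ ^ p := by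
  classical
  obtain ⟨v, l, hv, hl, htr⟩ := exists_orthonormal_eigenvectors f hD
  have hinner : ∀ j k, ⟪D (v j), D (v k)⟫ = if j = k then (l k : ℂ) else 0 := by
    intro j k
    rw [← adjoint_inner_right, ← star_eq_adjoint, ← mul_apply_eq_comp, hl, inner_smul_right,
      orthonormal_iff_ite.mp hv]
    simp
  have hnorm : ∀ k, ‖D (v k)‖ ^ 2 = l k := by
    intro k
    have := hinner k k
    rw [if_pos rfl, inner_self_eq_norm_sq_to_K] at this
    exact Complex.ofReal_injective (by rw [← this]; push_cast; rfl)
  have htrace : (trAbsPow f D p).toReal = ∑ k, l k ^ (p / 2) := by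
    have hnn := re_inner_nonneg_of_nonneg (absPow_nonneg D p)
    rw [trAbsPow_eq_sum f hp hD, ENNReal.toReal_ofReal (Finset.sum_nonneg fun _ _ => hnn _),
      ← map_sum, htr, map_sum]
    refine Finset.sum_congr rfl fun k _ => ?_
    rw [absPow_eq, cfc_apply_of_apply_eq_smul (.star_mul_self D) (hl k)
      (continuous_rpow_half (by linarith)), inner_smul_right, RCLike.re_to_complex,
      Complex.re_ofReal_mul, ← RCLike.re_to_complex, inner_self_eq_norm_sq, hv.1]
    simp
  have hl' : ∀ k, l k ^ (p / 2) = ‖D (v k)‖ ^ p := by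
    intro k
    rw [← hnorm, ← Real.rpow_natCast_mul (norm_nonneg _)]
    congr 1
    push_cast
    ring
  refine ⟨{k // D (v k) ≠ 0}, inferInstance, fun k => ((‖D (v k)‖⁻¹ : ℝ) : ℂ) • D (v k),
    fun k => v k, ?_, hv.comp _ Subtype.val_injective, ?_⟩
  · rw [orthonormal_iff_ite]
    intro j k
    rw [inner_smul_left, inner_smul_right, hinner, Complex.conj_ofReal]
    by_cases h : j = k
    · subst h
      have : ‖D (v j)‖ ≠ 0 := norm_ne_zero_iff.mpr j.2
      rw [if_pos rfl, if_pos rfl, ← hnorm]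
      norm_cast
      field_simp
    · rw [if_neg h, if_neg fun h' => h (Subtype.ext h')]
      simp
  · rw [htrace]
    simp_rw [hl']
    have hz : ∀ k, ‖D (v k)‖ ^ p = if D (v k) ≠ 0 then ‖D (v k)‖ ^ p else 0 := by
      intro k
      split_ifs with h
      · rfl
      · rw [not_not.mp h, norm_zero, Real.zero_rpow (by linarith)]
    rw [Finset.sum_congr rfl fun k _ => hz k, ← Finset.sum_filter,
      Finset.sum_subtype _ (p := fun k => D (v k) ≠ 0) fun k => by simp]
    refine Finset.sum_congr rfl fun k _ => ?_
    rw [inner_smul_left, Complex.conj_ofReal, inner_self_eq_norm_sq_to_K]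
    have hk : ‖D (v k)‖ ≠ 0 := norm_ne_zero_iff.mpr k.2
    congr 1
    rw [norm_mul, norm_pow, RCLike.norm_ofReal, Complex.norm_real, norm_inv, norm_norm,
      abs_norm, pow_two, inv_mul_cancel_left₀ hk]

theorem sq_trAbsPow_truncation_sub_le (f : HilbertBasis ℕ ℂ H) {p : ℝ} (hp : 1 ≤ p)
    (T : H →L[ℂ] H) (hfin : trAbsPow f T p ≠ ⊤) {n m : ℕ} (hnm : n ≤ m) :
    (trAbsPow f (basisProj f (Finset.range m) ∘L T ∘L basisProj f (Finset.range m) -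
      basisProj f (Finset.range n) ∘L T ∘L basisProj f (Finset.range n)) p).toReal ^ 2 ≤
      2 ^ (2 * p - 1) * ((trAbsPow f T p).toReal *
        ∑ i ∈ Finset.Ico n m,
          RCLike.re ⟪f i, (absPow T p + absPow (adjoint T) p) (f i)⟫) := by
  set P := basisProj f (Finset.range m) with hP
  set R := basisProj f (Finset.range n) with hR
  set Q := basisProj f (Finset.Ico n m) with hQ
  set D := P ∘L T ∘L P - R ∘L T ∘L R with hDdef
  have hPQ : P = R + Q := (Finset.sum_range_add_sum_Ico _ hnm).symm
  have hPP : P * P = P := by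
    rw [hP, basisProj_mul, Finset.inter_self]
  have hRP : R * P = R := by
    rw [hP, hR, basisProj_mul, Finset.inter_eq_left.mpr (Finset.range_mono hnm)]
  have hDP : D * P = D := by
    change (P * (T * P) - R * (T * R)) * P = P * (T * P) - R * (T * R)
    simp only [sub_mul, mul_assoc, hPP, hRP]
  obtain ⟨ι, _, u, v, hu, hv, htr⟩ := exists_orthonormal_toReal_trAbsPow_eq f hp hDP
  have hA0 := absPow_nonneg T p
  have hB0 := absPow_nonneg (adjoint T) p
  set t := (trAbsPow f T p).toReal
  set α : H → ℝ := fun x => RCLike.re ⟪x, absPow T p x⟫ with hα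
  set β : H → ℝ := fun x => RCLike.re ⟪x, absPow (adjoint T) p x⟫ with hβ
  have hα0 : ∀ x, 0 ≤ α x := re_inner_nonneg_of_nonneg hA0
  have hβ0 : ∀ x, 0 ≤ β x := re_inner_nonneg_of_nonneg hB0
  have hadj := trAbsPow_adjoint_le f T hp
  have hfin' : trAbsPow f (adjoint T) p ≠ ⊤ := ne_top_of_le_ne_top hfin hadj
  have ha : ∑ k, β (Q (u k)) ≤ ∑ i ∈ Finset.Ico n m, β (f i) :=
    hu.sum_re_inner_basisProj_le f _ hB0
  have hb : ∑ k, α (P (v k)) ≤ t :=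
    (hv.sum_re_inner_basisProj_le f _ hA0).trans (sum_re_inner_le_toReal_posTr f _ hA0 hfin)
  have hc : ∑ k, β (R (u k)) ≤ t :=
    ((hu.sum_re_inner_basisProj_le f _ hB0).trans
      (sum_re_inner_le_toReal_posTr f _ hB0 hfin')).trans (ENNReal.toReal_mono hfin hadj)
  have hd : ∑ k, α (Q (v k)) ≤ ∑ i ∈ Finset.Ico n m, α (f i) :=
    hv.sum_re_inner_basisProj_le f _ hA0
  set Sα := ∑ i ∈ Finset.Ico n m, α (f i) with hSα
  set Sβ := ∑ i ∈ Finset.Ico n m, β (f i) with hSβ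
  have ht0 : 0 ≤ t := ENNReal.toReal_nonneg
  have hSα0 : 0 ≤ Sα := Finset.sum_nonneg fun _ _ => hα0 _
  have hSβ0 : 0 ≤ Sβ := Finset.sum_nonneg fun _ _ => hβ0 _
  have hS : ∑ i ∈ Finset.Ico n m,
      RCLike.re ⟪f i, (absPow T p + absPow (adjoint T) p) (f i)⟫ = Sα + Sβ := by
    simp only [add_apply, inner_add_right, map_add, Finset.sum_add_distrib, hSα, hSβ, hα, hβ]
  have hcs : ∀ x y : ι → ℝ, (∀ k, 0 ≤ x k) → (∀ k, 0 ≤ y k) →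
      ∑ k, √(x k) * √(y k) ≤ √(∑ k, x k) * √(∑ k, y k) := fun x y hx hy =>
    Real.sum_sqrt_mul_sqrt_le _ hx hy
  have hterm : ∀ k, ‖⟪u k, D (v k)⟫‖ ^ p ≤ 2 ^ (p - 1) *
      (√(β (Q (u k))) * √(α (P (v k))) + √(β (R (u k))) * √(α (Q (v k)))) := by
    intro k
    have hsplit : ⟪u k, D (v k)⟫ = ⟪Q (u k), T (P (v k))⟫ + ⟪R (u k), T (Q (v k))⟫ := by
      rw [inner_basisProj_left, inner_basisProj_left, ← inner_add_right]
      congr 1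
      have hP' : ∀ x, P x = R x + Q x := fun x => by rw [hPQ, add_apply]
      simp only [hDdef, sub_apply, comp_apply, hP', map_add]
      abel
    have hu1 : ∀ s, ‖basisProj f s (u k)‖ ≤ 1 := fun s =>
      (norm_basisProj_apply_le f s _).trans (hu.1 k).le
    have hv1 : ∀ s, ‖basisProj f s (v k)‖ ≤ 1 := fun s =>
      (norm_basisProj_apply_le f s _).trans (hv.1 k).le
    calc ‖⟪u k, D (v k)⟫‖ ^ p
        ≤ (‖⟪Q (u k), T (P (v k))⟫‖ + ‖⟪R (u k), T (Q (v k))⟫‖) ^ p := by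
          rw [hsplit]
          exact Real.rpow_le_rpow (norm_nonneg _) (norm_add_le _ _) (by linarith)
      _ ≤ 2 ^ (p - 1) * (‖⟪Q (u k), T (P (v k))⟫‖ ^ p + ‖⟪R (u k), T (Q (v k))⟫‖ ^ p) :=
          mod_cast NNReal.rpow_add_le_mul_rpow_add_rpow ‖⟪Q (u k), T (P (v k))⟫‖₊
            ‖⟪R (u k), T (Q (v k))⟫‖₊ hp
      _ ≤ _ := by
          gcongr
          · exact norm_inner_rpow_le T hp (hu1 _) (hv1 _)
          · exact norm_inner_rpow_le T hp (hu1 _) (hv1 _)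
  have hsum : (trAbsPow f D p).toReal ≤ 2 ^ (p - 1) * (√Sβ * √t + √t * √Sα) := by
    rw [htr]
    refine (Finset.sum_le_sum fun k _ => hterm k).trans ?_
    rw [← Finset.mul_sum, Finset.sum_add_distrib]
    gcongr
    · exact (hcs _ _ (fun _ => hβ0 _) fun _ => hα0 _).trans (by gcongr)
    · exact (hcs _ _ (fun _ => hβ0 _) fun _ => hα0 _).trans (by gcongr)
  rw [hS]
  calc (trAbsPow f D p).toReal ^ 2 ≤ (2 ^ (p - 1) * (√Sβ * √t + √t * √Sα)) ^ 2 :=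
        pow_le_pow_left₀ ENNReal.toReal_nonneg hsum 2
    _ = (2 ^ (p - 1)) ^ 2 * (t * (√Sβ + √Sα) ^ 2) := by
        rw [show t = √t ^ 2 from (Real.sq_sqrt ht0).symm, Real.sqrt_sq (Real.sqrt_nonneg _)]
        ring
    _ ≤ (2 ^ (p - 1)) ^ 2 * (t * (2 * (Sα + Sβ))) := by
        gcongr
        nlinarith [sq_nonneg (√Sβ - √Sα), Real.sq_sqrt hSα0, Real.sq_sqrt hSβ0]
    _ = 2 ^ (2 * p - 1) * (t * (Sα + Sβ)) := by
        have : (2 : ℝ) ^ (2 * p - 1) = (2 ^ (p - 1)) ^ 2 * 2 := by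
          rw [← Real.rpow_mul_natCast zero_le_two, ← Real.rpow_add_one two_ne_zero]
          congr 1
          push_cast
          ring
        rw [this]
        ring

theorem sNorm_rpow_two_mul (f : HilbertBasis ℕ ℂ H) {p : ℝ} (hp : 1 ≤ p) (T : H →L[ℂ] H) :
    sNorm f p T ^ (2 * p) = (trAbsPow f T p).toReal ^ 2 := by
  rw [sNorm, ← Real.rpow_mul ENNReal.toReal_nonneg, ← Real.rpow_natCast]
  congr 1
  field_simp
  norm_num

theorem trAbsPow_le_of_mul_basisProj_eq (f : HilbertBasis ℕ ℂ H) {p : ℝ} (hp : 1 ≤ p)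
    {D : H →L[ℂ] H} {m : ℕ} (hD : D * basisProj f (Finset.range m) = D) :
    trAbsPow f D p ≤ ENNReal.ofReal (m * ‖D‖ ^ p) := by
  have : Nontrivial H := ⟨f 0, 0, f.orthonormal.ne_zero 0⟩
  have h : absPow D p ≤ 0 + algebraMap ℝ _ (‖D‖ ^ p) := by
    rw [zero_add, absPow_eq]
    refine cfc_le_algebraMap _ _ _ (fun t ht => ?_)
      (continuous_rpow_half (by linarith)).continuousOn
    have ht0 := spectrum_nonneg_of_nonneg (star_mul_self_nonneg D) ht
    have ht1 : t ≤ ‖D‖ ^ 2 := by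
      have := spectrum.norm_le_norm_of_mem ht
      rw [CStarRing.norm_star_mul_self, ← pow_two] at this
      exact (le_abs_self t).trans this
    calc t ^ (p / 2) ≤ (‖D‖ ^ 2) ^ (p / 2) := Real.rpow_le_rpow ht0 ht1 (by linarith)
      _ = ‖D‖ ^ p := by
        rw [← Real.rpow_natCast_mul (norm_nonneg _)]
        congr 1
        push_cast
        ring
  rw [trAbsPow_eq_sum f hp hD]
  refine ENNReal.ofReal_le_ofReal ?_
  calc ∑ i ∈ Finset.range m, RCLike.re ⟪f i, absPow D p (f i)⟫
      ≤ ∑ i ∈ Finset.range m, ‖D‖ ^ p := Finset.sum_le_sum fun i _ => by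
        have := re_inner_mono h (f i)
        rwa [re_inner_add_algebraMap, f.orthonormal.1 i, one_pow, mul_one, zero_apply,
          inner_zero_right, map_zero, zero_add] at this
    _ = m * ‖D‖ ^ p := by simp

omit [CompleteSpace H] in
theorem norm_truncation_le (f : HilbertBasis ℕ ℂ H) (s : Finset ℕ) (A : H →L[ℂ] H) :
    ‖basisProj f s ∘L A ∘L basisProj f s‖ ≤ ∑ j ∈ s, ∑ i ∈ s, ‖⟪f i, A (f j)⟫‖ := by
  refine opNorm_le_bound _ (by positivity) fun x => ?_
  rw [comp_apply, comp_apply, basisProj_apply f s x, map_sum, map_sum, Finset.sum_mul]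
  refine norm_sum_le_of_le _ fun j _ => ?_
  rw [map_smul, map_smul, basisProj_apply, norm_smul, mul_comm]
  gcongr
  · refine norm_sum_le_of_le _ fun i _ => ?_
    rw [norm_smul, f.orthonormal.1 i, mul_one]
  · refine (norm_inner_le_norm _ _).trans ?_
    rw [f.orthonormal.1 j, one_mul]

omit [CompleteSpace H] in
theorem truncation_mul_basisProj (f : HilbertBasis ℕ ℂ H) (s : Finset ℕ) (A : H →L[ℂ] H) :
    (basisProj f s ∘L A ∘L basisProj f s) * basisProj f s =
      basisProj f s ∘L A ∘L basisProj f s := by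
  change (_ * (A * _)) * _ = _ * (A * _)
  rw [mul_assoc, mul_assoc, basisProj_mul, Finset.inter_self]

theorem sNorm_truncation_le (f : HilbertBasis ℕ ℂ H) {p : ℝ} (hp : 1 ≤ p) (n : ℕ)
    (A : H →L[ℂ] H) :
    sNorm f p (basisProj f (Finset.range n) ∘L A ∘L basisProj f (Finset.range n)) ≤
      (n : ℝ) ^ (1 / p) *
        ∑ j ∈ Finset.range n, ∑ i ∈ Finset.range n, ‖⟪f i, A (f j)⟫‖ := by
  have hp0 : 0 < p := by linarith
  set D := basisProj f (Finset.range n) ∘L A ∘L basisProj f (Finset.range n)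
  have h := trAbsPow_le_of_mul_basisProj_eq f hp (truncation_mul_basisProj f (Finset.range n) A)
  have h' : (trAbsPow f D p).toReal ≤ n * ‖D‖ ^ p :=
    ENNReal.toReal_le_of_le_ofReal (by positivity) h
  calc sNorm f p D ≤ (n * ‖D‖ ^ p) ^ (1 / p) :=
        Real.rpow_le_rpow ENNReal.toReal_nonneg h' (by positivity)
    _ = (n : ℝ) ^ (1 / p) * ‖D‖ := by
        rw [Real.mul_rpow (by positivity) (by positivity), ← Real.rpow_mul (norm_nonneg _),
          mul_one_div_cancel hp0.ne', Real.rpow_one]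
    _ ≤ _ := by
        gcongr
        exact norm_truncation_le f _ A

theorem norm_inner_basis_le (f : HilbertBasis ℕ ℂ H) {p : ℝ} (hp : 1 ≤ p) (T : H →L[ℂ] H)
    (hfin : trAbsPow f T p ≠ ⊤) (i j : ℕ) :
    ‖⟪f i, T (f j)⟫‖ ≤ sNorm f p T := by
  have hadj := trAbsPow_adjoint_le f T hp
  have h1 := sum_re_inner_le_toReal_posTr f {j} (absPow_nonneg T p) hfin
  have h2 := (sum_re_inner_le_toReal_posTr f {i} (absPow_nonneg (adjoint T) p)
    (ne_top_of_le_ne_top hfin hadj)).trans (ENNReal.toReal_mono hfin hadj)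
  rw [Finset.sum_singleton] at h1 h2
  have h3 := norm_inner_rpow_le T hp (f.orthonormal.1 i).le (f.orthonormal.1 j).le
  have h4 : ‖⟪f i, T (f j)⟫‖ ^ p ≤ (trAbsPow f T p).toReal := by
    refine h3.trans ((mul_le_mul (Real.sqrt_le_sqrt h2) (Real.sqrt_le_sqrt h1)
      (Real.sqrt_nonneg _) (Real.sqrt_nonneg _)).trans (le_of_eq ?_))
    exact Real.mul_self_sqrt ENNReal.toReal_nonneg
  rw [sNorm, one_div]
  exact (Real.le_rpow_inv_iff_of_pos (norm_nonneg _) ENNReal.toReal_nonneg (by linarith)).mpr h4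

theorem sNorm_nonneg (f : HilbertBasis ℕ ℂ H) (p : ℝ) (T : H →L[ℂ] H) : 0 ≤ sNorm f p T :=
  Real.rpow_nonneg ENNReal.toReal_nonneg _

theorem isC0Schatten_truncation {X : Type*} [TopologicalSpace X] (f : HilbertBasis ℕ ℂ H)
    {p : ℝ} (hp : 1 ≤ p) {T : X → H →L[ℂ] H} (hcont : ∀ h, Continuous fun x => T x h)
    (hfin : ∀ x, trAbsPow f (T x) p ≠ ⊤)
    (h0 : Tendsto (fun x => (trAbsPow f (T x) p).toReal) (cocompact X) (𝓝 0)) (n : ℕ) :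
    IsC0Schatten f p fun x =>
      basisProj f (Finset.range n) ∘L T x ∘L basisProj f (Finset.range n) := by
  have hlim : ∀ (F : Filter X) (A : X → H →L[ℂ] H),
      (∀ i j, Tendsto (fun x => ‖⟪f i, A x (f j)⟫‖) F (𝓝 0)) →
      Tendsto (fun x => sNorm f p
        (basisProj f (Finset.range n) ∘L A x ∘L basisProj f (Finset.range n))) F (𝓝 0) := by
    intro F A hA
    refine squeeze_zero (fun _ => sNorm_nonneg _ _ _) (fun x => sNorm_truncation_le f hp n (A x)) ?_
    have := (tendsto_finsetSum (Finset.range n) fun j _ =>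
      tendsto_finsetSum (Finset.range n) fun i _ => hA i j).const_mul ((n : ℝ) ^ (1 / p))
    simpa using this
  refine ⟨fun x => ne_top_of_le_ne_top ENNReal.ofReal_ne_top
    (trAbsPow_le_of_mul_basisProj_eq f hp (truncation_mul_basisProj f _ _)), fun x => ?_, ?_⟩
  · have := hlim (𝓝 x) (fun y => T y - T x) fun i j => by
      have hc : Continuous fun y => ‖⟪f i, (T y - T x) (f j)⟫‖ := by
        simp only [sub_apply]
        exact (continuous_const.inner ((hcont (f j)).sub continuous_const)).norm
      simpa using hc.tendsto x
    simpa only [sub_comp, comp_sub] using this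
  · refine hlim _ _ fun i j => squeeze_zero (fun _ => norm_nonneg _)
      (fun x => norm_inner_basis_le f hp (T x) (hfin x) i j) ?_
    have := h0.rpow_const (p := 1 / p) (.inr (by positivity))
    rwa [Real.zero_rpow (by positivity)] at this

theorem trAbsPow_mul_sum_le (f : HilbertBasis ℕ ℂ H) {p : ℝ} (hp : 1 ≤ p) (T : H →L[ℂ] H)
    (hfin : trAbsPow f T p ≠ ⊤) (s : Finset ℕ) :
    (trAbsPow f T p).toReal *
      ∑ i ∈ s, RCLike.re ⟪f i, (absPow T p + absPow (adjoint T) p) (f i)⟫ ≤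
      2 * (trAbsPow f T p).toReal ^ 2 := by
  have hadj := trAbsPow_adjoint_le f T hp
  have h1 : ∑ i ∈ s, RCLike.re ⟪f i, absPow T p (f i)⟫ ≤ (trAbsPow f T p).toReal :=
    sum_re_inner_le_toReal_posTr f s (absPow_nonneg T p) hfin
  have h2 : ∑ i ∈ s, RCLike.re ⟪f i, absPow (adjoint T) p (f i)⟫ ≤ (trAbsPow f T p).toReal :=
    (sum_re_inner_le_toReal_posTr f s (absPow_nonneg (adjoint T) p)
      (ne_top_of_le_ne_top hfin hadj)).trans (ENNReal.toReal_mono hfin hadj)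
  simp only [add_apply, inner_add_right, map_add, Finset.sum_add_distrib]
  have h0 : 0 ≤ (trAbsPow f T p).toReal := ENNReal.toReal_nonneg
  nlinarith [mul_le_mul_of_nonneg_left (add_le_add h1 h2) h0]

end

/-- for a bounded *-strongly continuous `T : X → B(H)` with
`x ↦ tr|T(x)|^p ∈ C₀(X)`, the truncations `Tₙ(x) = Pₙ T(x) Pₙ` (with `Pₙ` the
projection onto the span of the first `n` basis vectors) lie in `C₀(X, S_p(H))` and
satisfy the explicit Cauchy estimate. -/
theorem truncations_c0Schatten_and_estimate {X : Type*} [TopologicalSpace X]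
    [LocallyCompactSpace X] [T2Space X]
    (f : HilbertBasis ℕ ℂ H) (p : ℝ) (hp : 1 ≤ p)
    (T : X → H →L[ℂ] H) (C : ℝ) (hbound : ∀ x, ‖T x‖ ≤ C)
    (hstrong : ∀ h : H, Continuous (fun x => T x h) ∧
      Continuous (fun x => ContinuousLinearMap.adjoint (T x) h))
    (hfin : ∀ x, trAbsPow f (T x) p ≠ ⊤)
    (hcont : Continuous fun x => (trAbsPow f (T x) p).toReal)
    (h0 : Tendsto (fun x => (trAbsPow f (T x) p).toReal) (cocompact X) (nhds 0)) :
    (∀ n : ℕ, IsC0Schatten f p (fun x =>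
      (∑ i ∈ Finset.range n, (innerSL ℂ (f i)).smulRight (f i)) ∘L T x ∘L
        (∑ i ∈ Finset.range n, (innerSL ℂ (f i)).smulRight (f i)))) ∧
    ∀ n m : ℕ, n ≤ m →
      (⨆ x, sNorm f p
          ((∑ i ∈ Finset.range m, (innerSL ℂ (f i)).smulRight (f i)) ∘L T x ∘L
             (∑ i ∈ Finset.range m, (innerSL ℂ (f i)).smulRight (f i)) -
           (∑ i ∈ Finset.range n, (innerSL ℂ (f i)).smulRight (f i)) ∘L T x ∘L
             (∑ i ∈ Finset.range n, (innerSL ℂ (f i)).smulRight (f i))) ^ (2 * p)) ≤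
      (2 : ℝ) ^ (2 * p - 1) *
        ⨆ x, (trAbsPow f (T x) p).toReal *
          ∑ i ∈ Finset.Ico n m,
            RCLike.re ⟪f i, (absPow (T x) p + absPow (ContinuousLinearMap.adjoint (T x)) p) (f i)⟫ := by
  have hP : ∀ s : Finset ℕ, ∑ i ∈ s, (innerSL ℂ (f i)).smulRight (f i) = basisProj f s :=
    fun _ => rfl
  simp only [hP]
  refine ⟨isC0Schatten_truncation f hp (fun h => (hstrong h).1) hfin h0, fun n m hnm => ?_⟩
  rcases isEmpty_or_nonempty X with hX | hX
  · simp
  obtain ⟨c, hc⟩ : ∃ c, ∀ x, (trAbsPow f (T x) p).toReal ≤ c := by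
    let F : ZeroAtInftyContinuousMap X ℝ := ⟨⟨_, hcont⟩, h0⟩
    obtain ⟨c, hc⟩ := F.isBounded_range.bddAbove
    exact ⟨c, fun x => hc ⟨x, rfl⟩⟩
  have hbdd : BddAbove (Set.range fun x => (trAbsPow f (T x) p).toReal *
      ∑ i ∈ Finset.Ico n m,
        RCLike.re ⟪f i, (absPow (T x) p + absPow (adjoint (T x)) p) (f i)⟫) := by
    refine ⟨2 * c ^ 2, Set.forall_mem_range.mpr fun y => ?_⟩
    refine (trAbsPow_mul_sum_le f hp (T y) (hfin y) _).trans ?_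
    have := pow_le_pow_left₀ ENNReal.toReal_nonneg (hc y) 2
    linarith
  refine ciSup_le fun x => ?_
  rw [sNorm_rpow_two_mul f hp]
  refine (sq_trAbsPow_truncation_sub_le f hp (T x) (hfin x) hnm).trans ?_
  exact mul_le_mul_of_nonneg_left (le_ciSup hbdd x) (by positivity)

end
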